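/- The linearized Bach tensor is divergence-free: for n = 4 and every smooth symmetric field h_{μν} : ℝ^4 → ℝ, one has ∂_α ℬ^{αβ}[h](x) = 0 for all β and all x ∈ ℝ^4. -/

import Mathlib

noncomputable section

open MeasureTheory

/-- Minkowski metric `diag(-1,1,…,1)` on `Fin n`. -/
def eta (n : ℕ) (μ ν : Fin n) : ℝ :=
  if μ = ν then (if (μ : ℕ) = 0 then -1 else 1) else 0

/-- Partial derivative in the coordinate direction `μ`. -/
def pd {n : ℕ} (μ : Fin n) (f : (Fin n → ℝ) → ℝ) : (Fin n → ℝ) → ℝ :=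
  fun x => fderiv ℝ f x (Pi.single μ 1)

/-- A rank-2 covariant field on `ℝ^n`. -/
abbrev TensorField (n : ℕ) := Fin n → Fin n → (Fin n → ℝ) → ℝ

/-- Linearized Riemann tensor
`ℛ_{αβγδ}[h] = −(1/2)(∂_α∂_γ h_{βδ} + ∂_β∂_δ h_{αγ} − ∂_α∂_δ h_{βγ} − ∂_β∂_γ h_{αδ})`. -/
def Riem {n : ℕ} (h : TensorField n) (α β γ δ : Fin n) : (Fin n → ℝ) → ℝ :=
  fun x => -(1/2) * (pd α (pd γ (h β δ)) x + pd β (pd δ (h α γ)) x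
    - pd α (pd δ (h β γ)) x - pd β (pd γ (h α δ)) x)

/-- Linearized Ricci tensor
`ℛ_{μν}[h] = (1/2) η^{αλ}(∂_μ∂_α h_{λν} − ∂_λ∂_α h_{μν} − ∂_μ∂_ν h_{λα} + ∂_λ∂_ν h_{μα})`. -/
def Ricci {n : ℕ} (h : TensorField n) (μ ν : Fin n) : (Fin n → ℝ) → ℝ :=
  fun x => (1/2) * ∑ α, ∑ l, eta n α l *
    (pd μ (pd α (h l ν)) x - pd l (pd α (h μ ν)) x
      - pd μ (pd ν (h l α)) x + pd l (pd ν (h μ α)) x)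

/-- Linearized scalar curvature `ℛ[h] = η^{αλ}η^{μν}(∂_λ∂_ν h_{μα} − ∂_α∂_λ h_{μν})`. -/
def Scal {n : ℕ} (h : TensorField n) : (Fin n → ℝ) → ℝ :=
  fun x => ∑ α, ∑ l, ∑ μ, ∑ ν, eta n α l * eta n μ ν *
    (pd l (pd ν (h μ α)) x - pd α (pd l (h μ ν)) x)

/-- Linearized Schouten-type tensor
`𝒦_{μν}[h] = (1/(n−2))(ℛ_{μν}[h] − η_{μν}ℛ[h]/(2(n−1)))`. -/
def Kt {n : ℕ} (h : TensorField n) (μ ν : Fin n) : (Fin n → ℝ) → ℝ :=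
  fun x => (1 / ((n : ℝ) - 2)) *
    (Ricci h μ ν x - eta n μ ν * Scal h x / (2 * ((n : ℝ) - 1)))

/-- Linearized Weyl tensor
`𝒲_{αβγδ}[h] = ℛ_{αβγδ}[h] − η_{αγ}𝒦_{δβ}[h] + η_{αδ}𝒦_{γβ}[h] + η_{βγ}𝒦_{δα}[h] − η_{βδ}𝒦_{γα}[h]`. -/
def Weyl {n : ℕ} (h : TensorField n) (α β γ δ : Fin n) : (Fin n → ℝ) → ℝ :=
  fun x => Riem h α β γ δ x - eta n α γ * Kt h δ β x + eta n α δ * Kt h γ β x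
    + eta n β γ * Kt h δ α x - eta n β δ * Kt h γ α x

/-- Linearized Cotton tensor `𝒞_{αβμ}[h] = ∂_μ𝒦_{βα}[h] − ∂_β𝒦_{μα}[h]`. -/
def Cotton {n : ℕ} (h : TensorField n) (α β μ : Fin n) : (Fin n → ℝ) → ℝ :=
  fun x => pd μ (Kt h β α) x - pd β (Kt h μ α) x

/-- Cotton tensor with all indices raised:
`𝒞^{αβρ}[h] = η^{αα'}η^{ββ'}η^{ρρ'}𝒞_{α'β'ρ'}[h]`. -/
def CottonUp {n : ℕ} (h : TensorField n) (α β ρ : Fin n) : (Fin n → ℝ) → ℝ :=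
  fun x => ∑ α', ∑ β', ∑ ρ', eta n α α' * eta n β β' * eta n ρ ρ' * Cotton h α' β' ρ' x

/-- Linearized Bach tensor `ℬ^{αβ}[h] = −2∂_ρ𝒞^{αβρ}[h]`. -/
def Bach {n : ℕ} (h : TensorField n) (α β : Fin n) : (Fin n → ℝ) → ℝ :=
  fun x => -2 * ∑ ρ, pd ρ (CottonUp h α β ρ) x

/-- Diagonal entry of the Minkowski metric. -/
def etaDiag (n : ℕ) (μ : Fin n) : ℝ := eta n μ μ

theorem sum_eta_mul {n : ℕ} (α : Fin n) (f : Fin n → ℝ) :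
    ∑ l, eta n α l * f l = etaDiag n α * f α := by
  rw [Finset.sum_eq_single α]
  · rfl
  · intro l _ hl
    simp [eta, hl.symm]
  · simp

theorem etaDiag_mul_self {n : ℕ} (μ : Fin n) : etaDiag n μ * etaDiag n μ = 1 := by
  unfold etaDiag eta
  split_ifs <;> simp_all

section PartialDerivatives

variable {n : ℕ} {f g : (Fin n → ℝ) → ℝ}

theorem contDiff_pd (hf : ContDiff ℝ (⊤ : ℕ∞) f) (μ : Fin n) :
    ContDiff ℝ (⊤ : ℕ∞) (pd μ f) :=
  (hf.fderiv_right (m := (⊤ : ℕ∞)) (by simp)).clm_apply contDiff_const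

theorem pd_add (hf : ContDiff ℝ (⊤ : ℕ∞) f) (hg : ContDiff ℝ (⊤ : ℕ∞) g) (μ : Fin n) :
    pd μ (fun x => f x + g x) = fun x => pd μ f x + pd μ g x := by
  funext x
  simp [pd, fderiv_fun_add (hf.differentiable (by simp) x) (hg.differentiable (by simp) x)]

theorem pd_sub (hf : ContDiff ℝ (⊤ : ℕ∞) f) (hg : ContDiff ℝ (⊤ : ℕ∞) g) (μ : Fin n) :
    pd μ (fun x => f x - g x) = fun x => pd μ f x - pd μ g x := by
  funext x
  simp [pd, fderiv_fun_sub (hf.differentiable (by simp) x) (hg.differentiable (by simp) x)]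

theorem pd_const_mul (hf : ContDiff ℝ (⊤ : ℕ∞) f) (c : ℝ) (μ : Fin n) :
    pd μ (fun x => c * f x) = fun x => c * pd μ f x := by
  funext x
  simp [pd, fderiv_const_mul (hf.differentiable (by simp) x)]

theorem pd_sum {ι : Type*} [Fintype ι] {F : ι → (Fin n → ℝ) → ℝ}
    (hF : ∀ i, ContDiff ℝ (⊤ : ℕ∞) (F i)) (μ : Fin n) :
    pd μ (fun x => ∑ i, F i x) = fun x => ∑ i, pd μ (F i) x := by
  funext x
  simp [pd, fderiv_fun_sum fun i _ => (hF i).differentiable (by simp) x]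

theorem pd_comm (hf : ContDiff ℝ (⊤ : ℕ∞) f) (μ ν : Fin n) : pd μ (pd ν f) = pd ν (pd μ f) := by
  funext x
  have hd : DifferentiableAt ℝ (fderiv ℝ f) x :=
    (hf.fderiv_right (m := (⊤ : ℕ∞)) (by simp)).differentiable (by simp) x
  have key : ∀ α β : Fin n, pd α (pd β f) x
      = fderiv ℝ (fderiv ℝ f) x (Pi.single α 1) (Pi.single β 1) := by
    intro α β
    change fderiv ℝ (fun y => fderiv ℝ f y (Pi.single β 1)) x (Pi.single α 1) = _
    rw [fderiv_clm_apply hd (differentiableAt_const _)]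
    simp
  rw [key, key]
  exact (hf.contDiffAt.isSymmSndFDerivAt (by simpa using WithTop.coe_le_coe.2 (le_top : (2 : ℕ∞) ≤ ⊤))) _ _

end PartialDerivatives

section Curvature

variable {n : ℕ} {h : TensorField n}

theorem Ricci_eq (h : TensorField n) (μ ν : Fin n) :
    Ricci h μ ν = fun x => (1 / 2) * ∑ α, etaDiag n α *
      (pd μ (pd α (h α ν)) x - pd α (pd α (h μ ν)) x
        - pd μ (pd ν (h α α)) x + pd α (pd ν (h μ α)) x) := by
  funext x
  simp only [Ricci, sum_eta_mul]

theorem Scal_eq (h : TensorField n) :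
    Scal h = fun x => ∑ α, ∑ μ, etaDiag n α * etaDiag n μ *
      (pd α (pd μ (h μ α)) x - pd α (pd α (h μ μ)) x) := by
  funext x
  simp only [Scal, mul_assoc, ← Finset.mul_sum, sum_eta_mul]

theorem contDiff_Ricci (hh : ∀ μ ν, ContDiff ℝ (⊤ : ℕ∞) (h μ ν)) (μ ν : Fin n) :
    ContDiff ℝ (⊤ : ℕ∞) (Ricci h μ ν) := by
  have H := fun α β γ δ => contDiff_pd (contDiff_pd (hh γ δ) β) α
  unfold Ricci
  fun_prop

theorem contDiff_Scal (hh : ∀ μ ν, ContDiff ℝ (⊤ : ℕ∞) (h μ ν)) :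
    ContDiff ℝ (⊤ : ℕ∞) (Scal h) := by
  have H := fun α β γ δ => contDiff_pd (contDiff_pd (hh γ δ) β) α
  unfold Scal
  fun_prop

theorem contDiff_Kt (hh : ∀ μ ν, ContDiff ℝ (⊤ : ℕ∞) (h μ ν)) (μ ν : Fin n) :
    ContDiff ℝ (⊤ : ℕ∞) (Kt h μ ν) := by
  have H₁ := contDiff_Ricci hh μ ν
  have H₂ := contDiff_Scal hh
  unfold Kt
  fun_prop

theorem Ricci_symm (hh : ∀ μ ν, ContDiff ℝ (⊤ : ℕ∞) (h μ ν)) (hsym : ∀ μ ν, h μ ν = h ν μ)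
    (μ ν : Fin n) : Ricci h μ ν = Ricci h ν μ := by
  rw [Ricci_eq, Ricci_eq]
  funext x
  congr 1
  refine Finset.sum_congr rfl fun α _ => ?_
  rw [pd_comm (hh α ν) μ α, pd_comm (hh α α) μ ν, pd_comm (hh μ α) α ν, pd_comm (hh α μ) ν α,
    hsym μ ν, hsym μ α, hsym ν α, pd_comm (hh α μ) ν α]
  ring

theorem Kt_symm (hh : ∀ μ ν, ContDiff ℝ (⊤ : ℕ∞) (h μ ν)) (hsym : ∀ μ ν, h μ ν = h ν μ)
    (μ ν : Fin n) : Kt h μ ν = Kt h ν μ := by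
  have hη : eta n μ ν = eta n ν μ := by
    unfold eta
    split_ifs <;> simp_all
  unfold Kt
  rw [Ricci_symm hh hsym μ ν, hη]

/-- The linearized contracted Bianchi identity. -/
theorem sum_pd_Ricci (hh : ∀ μ ν, ContDiff ℝ (⊤ : ℕ∞) (h μ ν)) (ν : Fin n) (x : Fin n → ℝ) :
    ∑ μ, etaDiag n μ * pd μ (Ricci h μ ν) x = (1 / 2) * pd ν (Scal h) x := by
  have H := fun α β γ δ => contDiff_pd (contDiff_pd (hh γ δ) β) α
  have hR : ∀ μ, pd μ (Ricci h μ ν) x = (1 / 2) * ∑ α, etaDiag n α *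
      (pd μ (pd μ (pd α (h α ν))) x - pd μ (pd α (pd α (h μ ν))) x
        - pd μ (pd μ (pd ν (h α α))) x + pd μ (pd α (pd ν (h μ α))) x) := by
    intro μ
    rw [Ricci_eq, pd_const_mul (by fun_prop), pd_sum (by fun_prop)]
    refine congrArg _ (Finset.sum_congr rfl fun α _ => ?_)
    rw [pd_const_mul (by fun_prop), pd_add (by fun_prop) (by fun_prop),
      pd_sub (by fun_prop) (by fun_prop), pd_sub (by fun_prop) (by fun_prop)]
  have hS : pd ν (Scal h) x = ∑ α, ∑ μ, etaDiag n α * etaDiag n μ *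
      (pd ν (pd α (pd μ (h μ α))) x - pd ν (pd α (pd α (h μ μ))) x) := by
    rw [Scal_eq, pd_sum (by fun_prop)]
    refine Finset.sum_congr rfl fun α _ => ?_
    rw [pd_sum (by fun_prop)]
    refine Finset.sum_congr rfl fun μ _ => ?_
    rw [pd_const_mul (by fun_prop), pd_sub (by fun_prop) (by fun_prop)]
  have hcancel : ∑ μ, ∑ α, etaDiag n μ * etaDiag n α * pd μ (pd μ (pd α (h α ν))) x
      = ∑ μ, ∑ α, etaDiag n μ * etaDiag n α * pd μ (pd α (pd α (h μ ν))) x := by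
    rw [Finset.sum_comm]
    refine Finset.sum_congr rfl fun μ _ => Finset.sum_congr rfl fun α _ => ?_
    rw [pd_comm (hh μ ν) α μ, pd_comm (contDiff_pd (hh μ ν) α) α μ, mul_comm (etaDiag n α)]
  have hdiv : ∑ μ, ∑ α, etaDiag n μ * etaDiag n α * pd μ (pd α (pd ν (h μ α))) x
      = ∑ μ, ∑ α, etaDiag n μ * etaDiag n α * pd ν (pd μ (pd α (h α μ))) x := by
    rw [Finset.sum_comm]
    refine Finset.sum_congr rfl fun μ _ => Finset.sum_congr rfl fun α _ => ?_
    rw [pd_comm (hh α μ) μ ν, pd_comm (contDiff_pd (hh α μ) μ) α ν, pd_comm (hh α μ) α μ,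
      mul_comm (etaDiag n α)]
  have hbox : ∀ μ α, pd μ (pd μ (pd ν (h α α))) x = pd ν (pd μ (pd μ (h α α))) x := by
    intro μ α
    rw [pd_comm (hh α α) μ ν, pd_comm (contDiff_pd (hh α α) μ) μ ν]
  calc ∑ μ, etaDiag n μ * pd μ (Ricci h μ ν) x
      = (1 / 2) * (∑ μ, ∑ α, etaDiag n μ * etaDiag n α * pd μ (pd μ (pd α (h α ν))) x
        - ∑ μ, ∑ α, etaDiag n μ * etaDiag n α * pd μ (pd α (pd α (h μ ν))) x
        - ∑ μ, ∑ α, etaDiag n μ * etaDiag n α * pd ν (pd μ (pd μ (h α α))) x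
        + ∑ μ, ∑ α, etaDiag n μ * etaDiag n α * pd μ (pd α (pd ν (h μ α))) x) := by
        simp only [hR, hbox, ← Finset.sum_sub_distrib, ← Finset.sum_add_distrib, Finset.mul_sum]
        refine Finset.sum_congr rfl fun μ _ => Finset.sum_congr rfl fun α _ => ?_
        ring
    _ = (1 / 2) * pd ν (Scal h) x := by
        rw [hcancel, hdiv, hS]
        simp only [mul_sub, Finset.sum_sub_distrib]
        ring

theorem pd_Kt (hh : ∀ μ ν, ContDiff ℝ (⊤ : ℕ∞) (h μ ν)) (α μ ν : Fin n) (x : Fin n → ℝ) :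
    pd α (Kt h μ ν) x = (1 / ((n : ℝ) - 2)) *
      (pd α (Ricci h μ ν) x - eta n μ ν / (2 * ((n : ℝ) - 1)) * pd α (Scal h) x) := by
  have H₁ := contDiff_Ricci hh μ ν
  have H₂ := contDiff_Scal hh
  have hK : Kt h μ ν = fun x => (1 / ((n : ℝ) - 2)) *
      (Ricci h μ ν x - eta n μ ν / (2 * ((n : ℝ) - 1)) * Scal h x) := by
    funext y
    simp only [Kt]
    ring
  rw [hK, pd_const_mul (by fun_prop), pd_sub (by fun_prop) (by fun_prop), pd_const_mul H₂]

/-- The divergence of the linearized Schouten tensor is a gradient. -/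
theorem sum_pd_Kt (hn : 3 ≤ n) (hh : ∀ μ ν, ContDiff ℝ (⊤ : ℕ∞) (h μ ν)) (ν : Fin n) :
    (fun x => ∑ μ, etaDiag n μ * pd μ (Kt h μ ν) x)
      = fun x => 1 / (2 * ((n : ℝ) - 1)) * pd ν (Scal h) x := by
  funext x
  have hn' : (3 : ℝ) ≤ n := by exact_mod_cast hn
  have h₁ : (n : ℝ) - 1 ≠ 0 := by linarith
  have h₂ : (n : ℝ) - 2 ≠ 0 := by linarith
  have hη : ∑ μ, etaDiag n μ * (eta n μ ν * pd μ (Scal h) x) = pd ν (Scal h) x := by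
    rw [Finset.sum_eq_single ν]
    · change etaDiag n ν * (etaDiag n ν * _) = _
      rw [← mul_assoc, etaDiag_mul_self, one_mul]
    · intro μ _ hμ
      simp [eta, hμ]
    · simp
  calc ∑ μ, etaDiag n μ * pd μ (Kt h μ ν) x
      = 1 / ((n : ℝ) - 2) * (∑ μ, etaDiag n μ * pd μ (Ricci h μ ν) x
        - 1 / (2 * ((n : ℝ) - 1)) * ∑ μ, etaDiag n μ * (eta n μ ν * pd μ (Scal h) x)) := by
        simp only [pd_Kt hh, Finset.mul_sum, ← Finset.sum_sub_distrib]
        refine Finset.sum_congr rfl fun μ _ => ?_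
        ring
    _ = 1 / (2 * ((n : ℝ) - 1)) * pd ν (Scal h) x := by
        rw [sum_pd_Ricci hh, hη]
        field_simp
        ring

theorem contDiff_Cotton (hh : ∀ μ ν, ContDiff ℝ (⊤ : ℕ∞) (h μ ν)) (α β μ : Fin n) :
    ContDiff ℝ (⊤ : ℕ∞) (Cotton h α β μ) :=
  (contDiff_pd (contDiff_Kt hh β α) μ).sub (contDiff_pd (contDiff_Kt hh μ α) β)

theorem CottonUp_eq (h : TensorField n) (α β ρ : Fin n) :
    CottonUp h α β ρ = fun x =>
      etaDiag n α * etaDiag n β * etaDiag n ρ * Cotton h α β ρ x := by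
  funext x
  simp only [CottonUp, mul_assoc, ← Finset.mul_sum, sum_eta_mul]

theorem pd_Bach (hh : ∀ μ ν, ContDiff ℝ (⊤ : ℕ∞) (h μ ν)) (α β : Fin n) (x : Fin n → ℝ) :
    pd α (Bach h α β) x = -2 * ∑ ρ, etaDiag n α * etaDiag n β * etaDiag n ρ *
      (pd α (pd ρ (pd ρ (Kt h β α))) x - pd α (pd ρ (pd β (Kt h ρ α))) x) := by
  have hC := contDiff_Cotton hh
  have hP := fun α β ρ => contDiff_pd (hC α β ρ) ρ
  have hB : Bach h α β = fun x => -2 * ∑ ρ, etaDiag n α * etaDiag n β * etaDiag n ρ *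
      pd ρ (Cotton h α β ρ) x := by
    funext y
    simp only [Bach, CottonUp_eq, pd_const_mul (hC _ _ _)]
  rw [hB, pd_const_mul (by fun_prop), pd_sum (by fun_prop)]
  refine congrArg _ (Finset.sum_congr rfl fun ρ _ => ?_)
  have h₁ := contDiff_pd (contDiff_Kt hh β α) ρ
  have h₂ := contDiff_pd (contDiff_Kt hh ρ α) β
  rw [pd_const_mul (hP _ _ _)]
  unfold Cotton
  rw [pd_sub h₁ h₂, pd_sub (contDiff_pd h₁ ρ) (contDiff_pd h₂ ρ)]

/-- The linearized Bach tensor expression is divergence-free in every dimension `n ≥ 3`. -/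
theorem sum_pd_Bach (hn : 3 ≤ n) (hh : ∀ μ ν, ContDiff ℝ (⊤ : ℕ∞) (h μ ν))
    (hsym : ∀ μ ν, h μ ν = h ν μ) (β : Fin n) (x : Fin n → ℝ) :
    ∑ α, pd α (Bach h α β) x = 0 := by
  have hK := contDiff_Kt hh
  have hK₁ := fun α μ ν => contDiff_pd (hK μ ν) α
  have hS := contDiff_Scal hh
  have hdiv : ∀ μ ν γ, ∑ α, etaDiag n α * pd μ (pd ν (pd α (Kt h α γ))) x
      = 1 / (2 * ((n : ℝ) - 1)) * pd μ (pd ν (pd γ (Scal h))) x := by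
    intro μ ν γ
    have e := congrArg (fun F => pd μ (pd ν F) x) (sum_pd_Kt hn hh γ)
    have hK₂ := fun α => contDiff_pd (hK₁ α α γ) ν
    have hS₁ := contDiff_pd hS γ
    beta_reduce at e
    rw [pd_const_mul hS₁, pd_const_mul (contDiff_pd hS₁ ν), pd_sum (by fun_prop)] at e
    simp only [pd_const_mul (hK₁ _ _ _)] at e
    rw [pd_sum (by fun_prop)] at e
    simpa only [pd_const_mul (hK₂ _)] using e
  have hcomm₁ : ∀ α ρ, pd α (pd ρ (pd ρ (Kt h β α))) x = pd ρ (pd ρ (pd α (Kt h α β))) x := by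
    intro α ρ
    rw [pd_comm (hK₁ ρ β α) α ρ, pd_comm (hK β α) α ρ, Kt_symm hh hsym β α]
  have hcomm₂ : ∀ α ρ, pd α (pd ρ (pd β (Kt h ρ α))) x = pd ρ (pd β (pd α (Kt h α ρ))) x := by
    intro α ρ
    rw [pd_comm (hK₁ β ρ α) α ρ, pd_comm (hK ρ α) α β, Kt_symm hh hsym ρ α]
  calc ∑ α, pd α (Bach h α β) x
      = -2 * etaDiag n β * ∑ ρ, etaDiag n ρ *
        (∑ α, etaDiag n α * pd ρ (pd ρ (pd α (Kt h α β))) x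
          - ∑ α, etaDiag n α * pd ρ (pd β (pd α (Kt h α ρ))) x) := by
        simp only [pd_Bach hh, hcomm₁, hcomm₂, Finset.mul_sum, ← Finset.sum_sub_distrib]
        rw [Finset.sum_comm]
        refine Finset.sum_congr rfl fun ρ _ => Finset.sum_congr rfl fun α _ => ?_
        ring
    _ = 0 := by
        simp [hdiv, pd_comm hS _ β]

end Curvature

/-- the linearized Bach tensor is divergence-free in four dimensions:
`∂_α ℬ^{αβ}[h] = 0`. -/
theorem bach_tensor_divergence_free
    (h : TensorField 4) (hsmooth : ∀ μ ν, ContDiff ℝ (⊤ : ℕ∞) (h μ ν))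
    (hsym : ∀ μ ν, h μ ν = h ν μ) :
    ∀ (β : Fin 4) (x : Fin 4 → ℝ),
      ∑ α, pd α (Bach h α β) x = 0 := by
  exact sum_pd_Bach (by norm_num) hsmooth hsym
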